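/- (a) Let A be a graded normal non-degenerate even tensor with respect to a diagonal ±1 parity matrix Z. Then there exists a positive definite matrix X ∈ M_D(ℂ) with Z X Z = X and Σ_j A^j X (A^j)† = X, and every matrix Y satisfying Σ_j A^j Y (A^j)† = Y is a scalar multiple of X. (b) Let A be a graded normal degenerate even tensor of the form A^i = (σ^x)^{|i|} ⊗ B^i with Z = σ^z ⊗ I_{D/2}. Then there exists a positive definite matrix ρ ∈ M_{D/2}(ℂ) such that the set of solutions Y of Σ_j A^j Y (A^j)† = Y is exactly the linear span of I₂ ⊗ ρ and σ^x ⊗ ρ; in particular the fixed points can be chosen as a pair consisting of one even and one odd operator. -/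

import Mathlib

open Matrix Kronecker
open scoped ComplexOrder

namespace FQCA

noncomputable section

/-- The sign `(-1)^x` associated with a parity `x ∈ ℤ₂`. -/
def sgn (x : ZMod 2) : ℂ := (-1 : ℂ) ^ x.val

/-- Entrywise complex conjugation of a matrix. -/
def mconj {m n : Type*} (A : Matrix m n ℂ) : Matrix m n ℂ := A.map (starRingEnd ℂ)

/-- A diagonal matrix with diagonal entries `±1`. -/
def IsParityMatrix {ν : Type*} (Z : Matrix ν ν ℂ) : Prop :=
  Z.IsDiag ∧ ∀ α, Z α α = 1 ∨ Z α α = -1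

/-- An even tensor: `Z * A i = (-1)^{|i|} A i * Z`. -/
def EvenTensor {ι ν : Type*} [Fintype ν] (p : ι → ZMod 2)
    (A : ι → Matrix ν ν ℂ) (Z : Matrix ν ν ℂ) : Prop :=
  ∀ i, Z * A i = sgn (p i) • (A i * Z)

/-- The transfer matrix `E_A = Σ_i A^i ⊗ conj (A^i)`. -/
def transfer {ι ν : Type*} [Fintype ι] (A : ι → Matrix ν ν ℂ) :
    Matrix (ν × ν) (ν × ν) ℂ :=
  ∑ i, (A i) ⊗ₖ (mconj (A i))

/-- `P` is the orthogonal projector of a nonzero proper graded invariant subspace for `A`. -/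
def GradedInvariantProj {ι ν : Type*} [Fintype ν] [DecidableEq ν]
    (A : ι → Matrix ν ν ℂ) (Z P : Matrix ν ν ℂ) : Prop :=
  P * P = P ∧ Pᴴ = P ∧ P ≠ 0 ∧ P ≠ 1 ∧ P * Z = Z * P ∧ ∀ i, A i * P = P * (A i * P)

/-- A graded irreducible tensor: no nonzero proper graded invariant subspace. -/
def GradedIrreducible {ι ν : Type*} [Fintype ν] [DecidableEq ν]
    (A : ι → Matrix ν ν ℂ) (Z : Matrix ν ν ℂ) : Prop :=
  ¬ ∃ P, GradedInvariantProj A Z P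

/-- A graded normal tensor, `mult = 1` (non-degenerate) or `2` (degenerate):
graded irreducible, `1` is an eigenvalue of the transfer matrix of algebraic multiplicity
`mult`, and all other eigenvalues have modulus `< 1`. -/
def GradedNormal {ι ν : Type*} [Fintype ι] [Fintype ν] [DecidableEq ν]
    (A : ι → Matrix ν ν ℂ) (Z : Matrix ν ν ℂ) (mult : ℕ) : Prop :=
  GradedIrreducible A Z ∧
  (Matrix.charpoly (transfer A)).rootMultiplicity 1 = mult ∧
  ∀ μ ∈ spectrum ℂ (transfer A), μ ≠ 1 → ‖μ‖ < 1

/-- Graded Canonical Form: `A^i = ⊕ₖ μₖ Aₖ^i` with `Z` block diagonal in the same way and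
every block a graded normal tensor. -/
def GCF {ι ν : Type*} [Fintype ι] [Fintype ν] [DecidableEq ν]
    (p : ι → ZMod 2) (A : ι → Matrix ν ν ℂ) (Z : Matrix ν ν ℂ) : Prop :=
  ∃ (g : ℕ) (Dk : Fin g → ℕ) (e : ν ≃ ((k : Fin g) × Fin (Dk k)))
    (μ : Fin g → ℂ)
    (Ak : (k : Fin g) → ι → Matrix (Fin (Dk k)) (Fin (Dk k)) ℂ)
    (Zk : (k : Fin g) → Matrix (Fin (Dk k)) (Fin (Dk k)) ℂ),
    0 < g ∧
    (∀ i, Matrix.reindex e e (A i) = Matrix.blockDiagonal' (fun k => μ k • Ak k i)) ∧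
    Matrix.reindex e e Z = Matrix.blockDiagonal' Zk ∧
    ∀ k, IsParityMatrix (Zk k) ∧ EvenTensor p (Ak k) (Zk k) ∧
      (GradedNormal (Ak k) (Zk k) 1 ∨ GradedNormal (Ak k) (Zk k) 2)

/-- The coefficient `tr(A^{n₁} ⋯ A^{n_N})` of the fMPS with antiperiodic boundary
conditions generated by the tensor `A`. -/
def mpsCoeff {ι ν : Type*} [Fintype ν] [DecidableEq ν] {N : ℕ}
    (A : ι → Matrix ν ν ℂ) (n : Fin N → ι) : ℂ :=
  ((List.ofFn fun j => A (n j)).prod).trace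

/-- The fermionic sign `σ(n,m) = Σ_{k<j} (|n_j|+|m_j|)·|m_k|` of an fMPO matrix element. -/
def mpoSign {ι : Type*} (p : ι → ZMod 2) {N : ℕ} (n m : Fin N → ι) : ZMod 2 :=
  ∑ jk ∈ Finset.univ.filter (fun jk : Fin N × Fin N => jk.2 < jk.1),
    (p (n jk.1) + p (m jk.1)) * p (m jk.2)

/-- The fMPO with antiperiodic boundary conditions generated by the MPO tensor `U`. -/
def fMPO {ι : Type*} (p : ι → ZMod 2) {ν : Type*} [Fintype ν] [DecidableEq ν]
    (U : ι → ι → Matrix ν ν ℂ) (N : ℕ) :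
    Matrix (Fin N → ι) (Fin N → ι) ℂ :=
  Matrix.of fun n m =>
    sgn (mpoSign p n m) * ((List.ofFn fun j => U (n j) (m j)).prod).trace

/-- The fMPO with periodic boundary conditions generated by the MPO tensor `U`
(parity operator `Z` inserted in the trace). -/
def fMPO_PBC {ι : Type*} (p : ι → ZMod 2) {ν : Type*} [Fintype ν] [DecidableEq ν]
    (Z : Matrix ν ν ℂ) (U : ι → ι → Matrix ν ν ℂ) (N : ℕ) :
    Matrix (Fin N → ι) (Fin N → ι) ℂ :=
  Matrix.of fun n m =>
    sgn (mpoSign p n m) * (Z * (List.ofFn fun j => U (n j) (m j)).prod).trace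

/-- The fermionic blocking sign `τ(n,m) = Σ_{j<l} |m_j|·(|n_l|+|m_l|)`. -/
def blockSign {ι : Type*} (p : ι → ZMod 2) {q : ℕ} (n m : Fin q → ι) : ZMod 2 :=
  ∑ jl ∈ Finset.univ.filter (fun jl : Fin q × Fin q => jl.1 < jl.2),
    p (m jl.1) * (p (n jl.2) + p (m jl.2))

/-- The `q`-fold blocked MPO tensor, with the fermionic blocking signs. -/
def blocked {ι : Type*} (p : ι → ZMod 2) {ν : Type*} [Fintype ν] [DecidableEq ν]
    (U : ι → ι → Matrix ν ν ℂ) (q : ℕ) :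
    (Fin q → ι) → (Fin q → ι) → Matrix ν ν ℂ :=
  fun n m => sgn (blockSign p n m) • ((List.ofFn fun j => U (n j) (m j)).prod)

/-- The right rank `r(U)`: rank of the matrix with entry
`(-1)^{|n||m|} (U^{n,m})_{α,β}` in row `(n,β)` and column `(m,α)`. -/
def rightRank {ι ν : Type*} [Fintype ι] [Fintype ν]
    (p : ι → ZMod 2) (U : ι → ι → Matrix ν ν ℂ) : ℕ :=
  (Matrix.of fun (r c : ι × ν) => sgn (p r.1 * p c.1) * U r.1 c.1 c.2 r.2).rank

/-- The left rank `ℓ(U)`: rank of the matrix with entry `(U^{n,m})_{α,β}`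
in row `(n,α)` and column `(m,β)`. -/
def leftRank {ι ν : Type*} [Fintype ι] [Fintype ν]
    (U : ι → ι → Matrix ν ν ℂ) : ℕ :=
  (Matrix.of fun (r c : ι × ν) => U r.1 c.1 r.2 c.2).rank

/-- The Pauli matrix `σˣ`, indexed by `Bool`. -/
def pauliX : Matrix Bool Bool ℂ := Matrix.of fun a b => if a = b then 0 else 1

/-- The Pauli matrix `σᶻ`, indexed by `Bool`. -/
def pauliZ : Matrix Bool Bool ℂ := Matrix.diagonal (fun b => if b then -1 else 1)

/-- The single-site physical parity matrix `P = diag((-1)^{|i|})`. -/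
def singleP {ι : Type*} [DecidableEq ι] (p : ι → ZMod 2) : Matrix ι ι ℂ :=
  Matrix.diagonal (fun i => sgn (p i))

/-- The parity of the doubled physical index `(n,m)` of an MPO tensor. -/
def doubledP {ι : Type*} (p : ι → ZMod 2) : ι × ι → ZMod 2 :=
  fun nm => p nm.1 + p nm.2

/-- An MPO tensor regarded as a tensor in the doubled physical index. -/
def doubledT {ι ν : Type*} (U : ι → ι → Matrix ν ν ℂ) : ι × ι → Matrix ν ν ℂ :=
  fun nm => U nm.1 nm.2

/-- An MPO tensor rescaled by `c`, regarded as a tensor in the doubled physical index. -/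
def mpoScaled {ι ν : Type*} (c : ℂ) (U : ι → ι → Matrix ν ν ℂ) : ι × ι → Matrix ν ν ℂ :=
  fun nm => c • U nm.1 nm.2

/-- The parity operator `σᶻ ⊗ I` on the bond space `Bool × Fin b`. -/
def ZBP (b : ℕ) : Matrix (Bool × Fin b) (Bool × Fin b) ℂ :=
  pauliZ ⊗ₖ (1 : Matrix (Fin b) (Fin b) ℂ)

/-- Structure of a type II MPO tensor: `U^{n,m} = (σˣ)^{|n|+|m|} ⊗ N^{n,m}`. -/
def TypeIIStruct {d b : ℕ} (p : Fin d → ZMod 2)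
    (U : Fin d → Fin d → Matrix (Bool × Fin b) (Bool × Fin b) ℂ) : Prop :=
  ∃ Nm : Fin d → Fin d → Matrix (Fin b) (Fin b) ℂ,
    ∀ n m', U n m' = (pauliX ^ (p n + p m').val) ⊗ₖ Nm n m'

/-- The parity matrix of the product grading on `q` sites. -/
def bigP {d : ℕ} (p : Fin d → ZMod 2) (q : ℕ) :
    Matrix (Fin q → Fin d) (Fin q → Fin d) ℂ :=
  Matrix.diagonal (fun n => sgn (∑ i, p (n i)))

/-- The Jordan-Wigner embedding at site `j` of a local operator `O` homogeneous of
parity `o`: `P^{|O|} ⊗ ⋯ ⊗ P^{|O|} ⊗ O ⊗ I ⊗ ⋯ ⊗ I`. -/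
def jordanWigner {d N : ℕ} (p : Fin d → ZMod 2) (o : ZMod 2)
    (O : Matrix (Fin d) (Fin d) ℂ) (j : Fin N) :
    Matrix (Fin N → Fin d) (Fin N → Fin d) ℂ :=
  Matrix.of fun n m =>
    (∏ l ∈ Finset.univ.filter (fun l : Fin N => l < j),
      ((singleP p) ^ o.val) (n l) (m l)) *
    O (n j) (m j) *
    (∏ l ∈ Finset.univ.filter (fun l : Fin N => j < l),
      (if n l = m l then (1:ℂ) else 0))

open Filter Topology

/-- Powers of an element of spectral radius less than one tend to zero. -/
theorem tendsto_pow_of_spectralRadius_lt_one {A : Type*} [NormedRing A] [NormedAlgebra ℂ A]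
    [CompleteSpace A] (a : A) (h : spectralRadius ℂ a < 1) :
    Tendsto (fun n : ℕ => a ^ n) atTop (𝓝 0) := by
  obtain ⟨q, hq, hq1⟩ := exists_between h
  lift q to NNReal using (hq1.trans_le le_top).ne
  have hev := (spectrum.pow_nnnorm_pow_one_div_tendsto_nhds_spectralRadius a).eventually_lt_const hq
  have hq1' : (q : ℝ) < 1 := by exact_mod_cast hq1
  refine squeeze_zero_norm' ?_ (tendsto_pow_atTop_nhds_zero_of_lt_one q.2 hq1')
  filter_upwards [hev, eventually_ge_atTop 1] with n hn hn1
  have hn0 : (n : ℝ) ≠ 0 := by positivity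
  have h2 := ENNReal.rpow_le_rpow hn.le (Nat.cast_nonneg (α := ℝ) n)
  rw [← ENNReal.rpow_mul, one_div_mul_cancel hn0, ENNReal.rpow_one, ENNReal.rpow_natCast] at h2
  exact_mod_cast h2

section PositiveMaps

variable {A : Type*} [CStarAlgebra A] [PartialOrder A] [StarOrderedRing A]

/-- A positive map `E` such that `R - E R` is a positive multiple of `1` for some `R ≥ 0` has no
nonzero fixed points. -/
theorem eq_zero_of_map_eq_self_of_sub_map_eq_smul_one {E : Module.End ℂ A}
    (hpos : ∀ X, 0 ≤ X → 0 ≤ E X) (hstar : ∀ X, E (star X) = star (E X))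
    {R : A} (hR : 0 ≤ R) {c : ℝ} (hc : 0 < c) (hRE : R - E R = c • 1)
    {Y : A} (hY : E Y = Y) : Y = 0 := by
  have hmono : ∀ X X', X ≤ X' → E X ≤ E X' := fun X X' h => by
    simpa using hpos _ (sub_nonneg.2 h)
  have hsmul : ∀ (t : ℝ) X, E (t • X) = t • E X := fun t X => E.map_smul_of_tower t X
  set q : ℝ := ‖R‖ / (‖R‖ + c) with hq
  have hK : 0 < ‖R‖ + c := by positivity
  have hq0 : 0 ≤ q := by positivity
  have hq1 : q < 1 := by rw [hq, div_lt_one hK]; linarith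
  have hle : R ≤ (‖R‖ + c) • (1 : A) := by
    refine ((IsSelfAdjoint.of_nonneg hR).le_algebraMap_norm_self).trans ?_
    rw [Algebra.algebraMap_eq_smul_one]
    exact smul_le_smul_of_nonneg_right (by linarith) zero_le_one
  have hER : E R ≤ q • R := by
    have h1 := smul_le_smul_of_nonneg_left hle (show 0 ≤ c / (‖R‖ + c) by positivity)
    rw [smul_smul, div_mul_cancel₀ _ hK.ne', ← hRE] at h1
    have h2 : q • R = R - (c / (‖R‖ + c)) • R := by
      have : q = 1 - c / (‖R‖ + c) := by rw [hq]; field_simp; ring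
      rw [this, sub_smul, one_smul]
    rw [h2]
    exact le_sub_comm.1 h1
  have hone : (1 : A) ≤ c⁻¹ • R := by
    have h1 : c • (1 : A) ≤ R := by rw [← hRE]; exact sub_le_self _ (hpos _ hR)
    have := smul_le_smul_of_nonneg_left h1 (inv_pos.2 hc).le
    rwa [smul_smul, inv_mul_cancel₀ hc.ne', one_smul] at this
  have key : ∀ W : A, IsSelfAdjoint W → E W = W → W ≤ 0 := by
    intro W hW hEW
    have hn : ∀ n : ℕ, W ≤ (q ^ n * (‖W‖ * c⁻¹)) • R := by
      intro n
      induction n with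
      | zero =>
        refine (hW.le_algebraMap_norm_self).trans ?_
        rw [Algebra.algebraMap_eq_smul_one, pow_zero, one_mul, mul_smul]
        exact smul_le_smul_of_nonneg_left hone (norm_nonneg _)
      | succ n ih =>
        have h1 := hmono _ _ ih
        rw [hEW, hsmul] at h1
        refine h1.trans ((smul_le_smul_of_nonneg_left hER (by positivity)).trans_eq ?_)
        rw [smul_smul]; congr 1; ring
    have hlim : Tendsto (fun n : ℕ => (q ^ n * (‖W‖ * c⁻¹)) • R) atTop (𝓝 0) := by
      have := ((tendsto_pow_atTop_nhds_zero_of_lt_one hq0 hq1).mul_const (‖W‖ * c⁻¹)).smul_const R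
      simpa using this
    exact ge_of_tendsto' hlim hn
  have key0 : ∀ W : A, IsSelfAdjoint W → E W = W → W = 0 := fun W hW hEW =>
    le_antisymm (key W hW hEW) (by simpa using key (-W) hW.neg (by rw [map_neg, hEW]))
  have h1 := key0 _ (IsSelfAdjoint.add_star_self Y) (by rw [map_add, hstar, hY])
  have h2 := key0 (Complex.I • (Y - star Y)) (by
    rw [isSelfAdjoint_iff]; simp [star_smul, ← smul_neg]) (by rw [map_smul, map_sub, hstar, hY])
  have h3 := (smul_eq_zero.1 h2).resolve_left Complex.I_ne_zero
  have h4 : (2 : ℂ) • Y = 0 := by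
    rw [two_smul]
    calc Y + Y = (Y + star Y) + (Y - star Y) := by abel
      _ = 0 := by rw [h1, h3, add_zero]
  exact (smul_eq_zero.1 h4).resolve_left two_ne_zero

variable [FiniteDimensional ℂ A]

/-- The resolvent of a positive map of spectral radius at most one is positive at `r > 1`. -/
theorem nonneg_of_smul_sub_map_eq_one {E : Module.End ℂ A}
    (hpos : ∀ X, 0 ≤ X → 0 ≤ E X) (hspec : ∀ μ ∈ spectrum ℂ E, ‖μ‖ ≤ 1)
    {r : ℝ} (hr : 1 < r) {R : A} (hR : r • R - E R = 1) : 0 ≤ R := by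
  have hr0 : 0 < r := by linarith
  set T : Module.End ℂ A := ((r⁻¹ : ℝ) : ℂ) • E with hT
  have hTa : ∀ X, T X = r⁻¹ • E X := fun X => by
    rw [hT, LinearMap.smul_apply, Complex.coe_smul]
  have hTmono : ∀ X X', X ≤ X' → T X ≤ T X' := fun X X' h => by
    have := smul_nonneg (inv_pos.2 hr0).le (hpos _ (sub_nonneg.2 h))
    rw [← hTa, map_sub] at this
    exact sub_nonneg.1 this
  have hTR : T R ≤ R := by
    have h1 : R - T R = r⁻¹ • 1 := by
      rw [← hR, smul_sub, smul_smul, inv_mul_cancel₀ hr0.ne', one_smul, hTa]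
    rw [← sub_nonneg, h1]
    exact smul_nonneg (inv_pos.2 hr0).le zero_le_one
  have hle : ∀ n : ℕ, (T ^ n) R ≤ R := by
    intro n
    induction n with
    | zero => simp
    | succ n ih => rw [pow_succ']; exact (hTmono _ _ ih).trans hTR
  let e := Module.End.toContinuousLinearMap (𝕜 := ℂ) A
  have hspecT : spectralRadius ℂ (e T) < 1 := by
    obtain ⟨q, hq⟩ : ∃ q : NNReal, (q : ℝ) = r⁻¹ := ⟨⟨r⁻¹, (inv_pos.2 hr0).le⟩, rfl⟩
    refine (iSup₂_le (a := (q : ENNReal)) ?_).trans_lt ?_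
    · intro μ hμ
      rw [AlgEquiv.spectrum_eq, hT] at hμ
      have hne : ((r⁻¹ : ℝ) : ℂ) ≠ 0 := by exact_mod_cast (inv_pos.2 hr0).ne'
      have h2 : ‖(r : ℂ) * μ‖ ≤ 1 := by
        apply hspec
        have := spectrum.unit_smul_eq_smul E (Units.mk0 _ hne)
        rw [Units.smul_def, Units.val_mk0] at this
        rw [this] at hμ
        obtain ⟨ν, hν, rfl⟩ := Set.mem_smul_set.1 hμ
        have : (r : ℂ) ≠ 0 := by exact_mod_cast hr0.ne'
        simpa [Units.smul_def, this] using hν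
      rw [norm_mul, Complex.norm_real, Real.norm_of_nonneg hr0.le] at h2
      norm_cast
      rw [← NNReal.coe_le_coe]
      rw [coe_nnnorm, hq, ← one_div, le_div_iff₀ hr0]; linarith
    · norm_cast
      rw [← NNReal.coe_lt_coe]
      simpa [hq] using inv_lt_one_of_one_lt₀ hr
  have hlim := tendsto_pow_of_spectralRadius_lt_one _ hspecT
  have hlim2 : Tendsto (fun n : ℕ => (T ^ n) R) atTop (𝓝 0) := by
    have h1 := ((ContinuousLinearMap.apply ℂ A R).continuous.tendsto 0).comp hlim
    rw [map_zero] at h1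
    refine h1.congr fun n => ?_
    simp only [Function.comp, ContinuousLinearMap.apply_apply, ← map_pow]
    rfl
  exact le_of_tendsto' hlim2 hle

/-- A positive map whose spectrum lies in the closed unit disc and contains `1` has a nonzero
positive fixed point: a cluster point of the normalised resolvents at `r → 1⁺`. -/
theorem exists_nonneg_map_eq_self [Nontrivial A] {E : Module.End ℂ A}
    (hpos : ∀ X, 0 ≤ X → 0 ≤ E X) (hstar : ∀ X, E (star X) = star (E X))
    (hspec : ∀ μ ∈ spectrum ℂ E, ‖μ‖ ≤ 1) (hone : E.HasEigenvalue 1) :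
    ∃ X, 0 ≤ X ∧ X ≠ 0 ∧ E X = X := by
  have hex : ∀ n : ℕ, ∃ R : A, 0 ≤ R ∧ (1 + 1 / ((n : ℝ) + 1)) • R - E R = 1 := by
    intro n
    set r : ℝ := 1 + 1 / ((n : ℝ) + 1) with hr
    have hr1 : 1 < r := by rw [hr, lt_add_iff_pos_right]; positivity
    have hu : IsUnit (algebraMap ℂ (Module.End ℂ A) r - E) := by
      by_contra h
      have := hspec r h
      rw [Complex.norm_real, Real.norm_of_nonneg (by linarith)] at this
      linarith
    obtain ⟨R, hR⟩ := ((Module.End.isUnit_iff _).1 hu).2 1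
    have hR' : r • R - E R = 1 := by
      rw [← hR]; simp [Module.algebraMap_end_apply]
    exact ⟨R, nonneg_of_smul_sub_map_eq_one hpos hspec hr1 hR', hR'⟩
  choose R hR0 hR using hex
  have hRne : ∀ n, R n ≠ 0 := fun n h => by
    have := hR n
    simp [h] at this
  have : ProperSpace A := FiniteDimensional.proper ℂ A
  obtain ⟨X, hX, φ, hφ, hlim⟩ := (isCompact_sphere (0 : A) 1).tendsto_subseq
    (x := fun n => ‖R n‖⁻¹ • R n) (fun n => by
      simp [norm_smul, inv_mul_cancel₀ (norm_ne_zero_iff.2 (hRne n))])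
  have hX0 : 0 ≤ X := ge_of_tendsto' hlim fun n =>
    smul_nonneg (inv_nonneg.2 (norm_nonneg _)) (hR0 _)
  have hXne : X ≠ 0 := by
    rintro rfl
    simp at hX
  have hEc : Continuous E := LinearMap.continuous_of_finiteDimensional E
  have hr : Tendsto (fun n : ℕ => 1 + 1 / ((φ n : ℝ) + 1)) atTop (𝓝 1) := by
    have := (tendsto_one_div_add_atTop_nhds_zero_nat (𝕜 := ℝ)).comp hφ.tendsto_atTop
    simpa using this.const_add 1
  have hlim2 : Tendsto (fun n : ℕ => ‖R (φ n)‖⁻¹ • (1 : A)) atTop (𝓝 (X - E X)) := by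
    have h1 := (hr.smul hlim).sub ((hEc.tendsto X).comp hlim)
    rw [one_smul] at h1
    refine h1.congr fun n => ?_
    simp only [Function.comp]
    rw [← hR (φ n), LinearMap.map_smul_of_tower, smul_sub, smul_comm]
  have hc : Tendsto (fun n : ℕ => ‖R (φ n)‖⁻¹) atTop (𝓝 ‖X - E X‖) := by
    refine hlim2.norm.congr fun n => ?_
    rw [norm_smul, CStarRing.norm_one, mul_one, norm_inv, norm_norm]
  have heq : X - E X = ‖X - E X‖ • 1 := tendsto_nhds_unique hlim2 (hc.smul_const 1)
  refine ⟨X, hX0, hXne, ?_⟩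
  by_contra hne
  have hpos' : 0 < ‖X - E X‖ := norm_pos_iff.2 (sub_ne_zero.2 (Ne.symm hne))
  obtain ⟨Y, hY⟩ := hone.exists_hasEigenvector
  exact hY.2 (eq_zero_of_map_eq_self_of_sub_map_eq_smul_one hpos hstar hX0 hpos' heq
    (by simpa using hY.apply_eq_smul))
end PositiveMaps

theorem IsParityMatrix.conjTranspose_eq {ν : Type*} [DecidableEq ν] {Z : Matrix ν ν ℂ}
    (hZ : IsParityMatrix Z) : Zᴴ = Z := by
  rw [← hZ.1.diagonal_diag, diagonal_conjTranspose]
  congr 1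
  ext α
  rcases hZ.2 α with h | h <;> simp [h]

section
variable {ι ν : Type*} [Fintype ι] [Fintype ν]

/-- The completely positive map `Y ↦ Σ_j A^j Y (A^j)†`. -/
def channel (A : ι → Matrix ν ν ℂ) : Module.End ℂ (Matrix ν ν ℂ) where
  toFun Y := ∑ j, A j * Y * (A j)ᴴ
  map_add' X Y := by simp [Matrix.mul_add, Matrix.add_mul, Finset.sum_add_distrib]
  map_smul' c X := by simp [Finset.smul_sum]

theorem channel_apply (A : ι → Matrix ν ν ℂ) (Y : Matrix ν ν ℂ) :
    channel A Y = ∑ j, A j * Y * (A j)ᴴ := rfl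

theorem posSemidef_channel (A : ι → Matrix ν ν ℂ) {X : Matrix ν ν ℂ} (hX : X.PosSemidef) :
    (channel A X).PosSemidef :=
  posSemidef_sum _ fun j _ => hX.mul_mul_conjTranspose_same (A j)

theorem channel_conjTranspose (A : ι → Matrix ν ν ℂ) (X : Matrix ν ν ℂ) :
    channel A Xᴴ = (channel A X)ᴴ := by
  simp [channel_apply, conjTranspose_sum, conjTranspose_mul, Matrix.mul_assoc]

theorem charpoly_channel [DecidableEq ν] (A : ι → Matrix ν ν ℂ) :
    (channel A).charpoly = (transfer A).charpoly := by
  rw [← charpoly_toLin', ← LinearEquiv.charpoly_conj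
    (LinearEquiv.curry ℂ ℂ ν ν ≪≫ₗ ofLinearEquiv ℂ) (toLin' _)]
  congr 1
  refine LinearMap.ext fun Y => Matrix.ext fun i j => ?_
  have h : (LinearEquiv.curry ℂ ℂ ν ν ≪≫ₗ ofLinearEquiv ℂ).conj (toLin' (transfer A)) Y i j =
      (transfer A *ᵥ fun x => Y x.1 x.2) (i, j) := rfl
  rw [h, channel_apply, transfer, Matrix.sum_mulVec]
  simp only [Matrix.sum_apply, Finset.sum_apply]
  refine Finset.sum_congr rfl fun k _ => ?_
  simp only [mconj, Matrix.mul_apply, Finset.sum_mul, mulVec, dotProduct, Fintype.sum_prod_type,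
    kroneckerMap_apply, map_apply, conjTranspose_apply]
  rw [Finset.sum_comm]
  exact Finset.sum_congr rfl fun _ _ => Finset.sum_congr rfl fun _ _ => mul_right_comm _ _ _

theorem channel_conj (A : ι → Matrix ν ν ℂ) {U : Matrix ν ν ℂ} (s : ι → ℂ)
    (hs : ∀ j, s j * star (s j) = 1) (hU : ∀ j, A j * U = s j • (U * A j)) (X : Matrix ν ν ℂ) :
    channel A (U * X * Uᴴ) = U * channel A X * Uᴴ := by
  simp only [channel_apply, Finset.mul_sum, Finset.sum_mul]
  refine Finset.sum_congr rfl fun j _ => ?_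
  calc A j * (U * X * Uᴴ) * (A j)ᴴ = (A j * U) * X * (A j * U)ᴴ := by
        simp only [conjTranspose_mul, Matrix.mul_assoc]
    _ = (s j * star (s j)) • (U * (A j * X * (A j)ᴴ) * Uᴴ) := by
        rw [hU, conjTranspose_smul, Matrix.smul_mul, Matrix.smul_mul, Matrix.mul_smul, smul_smul]
        simp only [conjTranspose_mul, Matrix.mul_assoc]
    _ = _ := by rw [hs, one_smul]

theorem channel_mul_of_commute (A : ι → Matrix ν ν ℂ) {U : Matrix ν ν ℂ}
    (hU : ∀ j, A j * U = U * A j) (X : Matrix ν ν ℂ) :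
    channel A (U * X) = U * channel A X := by
  simp only [channel_apply, Finset.mul_sum]
  refine Finset.sum_congr rfl fun j _ => ?_
  simp only [← Matrix.mul_assoc, hU]

variable [DecidableEq ν]

theorem IsParityMatrix.mul_self {Z : Matrix ν ν ℂ} (hZ : IsParityMatrix Z) : Z * Z = 1 := by
  rw [← hZ.1.diagonal_diag, diagonal_mul_diagonal, ← diagonal_one]
  congr 1
  ext α
  rcases hZ.2 α with h | h <;> simp [h]

theorem sgn_mul_self (x : ZMod 2) : sgn x * sgn x = 1 := by
  rw [sgn, ← mul_pow]; simp

theorem star_sgn (x : ZMod 2) : star (sgn x) = sgn x := by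
  simp [sgn]

theorem channel_parity_conj {p : ι → ZMod 2} {A : ι → Matrix ν ν ℂ} {Z : Matrix ν ν ℂ}
    (hZ : IsParityMatrix Z) (hA : EvenTensor p A Z) (X : Matrix ν ν ℂ) :
    channel A (Z * X * Z) = Z * channel A X * Z := by
  have h := channel_conj A (U := Z) (fun j => sgn (p j))
    (fun j => by rw [star_sgn, sgn_mul_self])
    (fun j => by rw [hA j, smul_smul, sgn_mul_self, one_smul]) X
  rwa [hZ.conjTranspose_eq] at h

open scoped MatrixOrder Matrix.Norms.L2Operator

/-- A nonzero positive semidefinite even fixed point of a graded irreducible tensor is positive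
definite: otherwise the projector onto its range is a proper graded invariant subspace. -/
theorem GradedIrreducible.posDef_of_channel_eq_self {A : ι → Matrix ν ν ℂ} {Z : Matrix ν ν ℂ}
    (hirr : GradedIrreducible A Z) {W : Matrix ν ν ℂ} (hW : W.PosSemidef) (hW0 : W ≠ 0)
    (hWZ : W * Z = Z * W) (hfix : channel A W = W) : W.PosDef := by
  rw [hW.posDef_iff_isUnit]
  have hsa : IsSelfAdjoint W := hW.1
  have hcont : ∀ f : ℝ → ℝ, ContinuousOn f (spectrum ℝ W) := fun f =>
    (Matrix.finite_real_spectrum (A := W)).continuousOn f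
  set G : Matrix ν ν ℂ := cfc (fun x : ℝ => x⁻¹) W
  set P := W * G with hP
  have hid : cfc (fun x : ℝ => x) W = W := cfc_id' ℝ W
  have hPcfc : P = cfc (fun x : ℝ => x * x⁻¹) W := by
    rw [cfc_mul _ _ _ (hcont _) (hcont _), hid]
  have hPP : P * P = P := by
    rw [hPcfc, ← cfc_mul _ _ _ (hcont _) (hcont _)]
    congr 1
    ext x
    by_cases hx : x = 0 <;> simp [hx]
  have hPW : P * W = W := by
    conv_rhs => rw [← hid]
    rw [hPcfc]
    nth_rewrite 2 [← hid]
    rw [← cfc_mul _ _ _ (hcont _) (hcont _)]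
    congr 1
    ext x
    by_cases hx : x = 0 <;> simp [hx]
  have hPsa : Pᴴ = P := by
    rw [hPcfc]; exact cfc_predicate (R := ℝ) (p := IsSelfAdjoint) _ W
  have hPZ : P * Z = Z * P := by
    have : Commute W Z := hWZ
    rw [hPcfc]
    exact this.cfc_real _
  have hP0 : P ≠ 0 := by
    intro h
    rw [h, Matrix.zero_mul] at hPW
    exact hW0 hPW.symm
  have hinv : ∀ i, A i * P = P * (A i * P) := by
    intro i
    have hsum : ∑ j, ((1 - P) * A j) * W * ((1 - P) * A j)ᴴ = 0 := by
      have : (1 - P) * channel A W * (1 - P)ᴴ = 0 := by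
        rw [hfix, Matrix.sub_mul, hPW, Matrix.one_mul, sub_self, Matrix.zero_mul]
      rw [← this, channel_apply, Finset.mul_sum, Finset.sum_mul]
      simp only [conjTranspose_mul, Matrix.mul_assoc]
    have hz := (Finset.sum_eq_zero_iff_of_nonneg (fun j _ =>
      (hW.mul_mul_conjTranspose_same ((1 - P) * A j)).nonneg)).1 hsum i (Finset.mem_univ i)
    obtain ⟨C, hC⟩ := CStarAlgebra.nonneg_iff_eq_star_mul_self.1 hW.nonneg
    rw [star_eq_conjTranspose] at hC
    have h1 : (1 - P) * A i * Cᴴ = 0 := by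
      rw [← self_mul_conjTranspose_eq_zero (A := (1 - P) * A i * Cᴴ), ← hz, hC]
      simp only [conjTranspose_mul, conjTranspose_conjTranspose, Matrix.mul_assoc]
    have h2 : (1 - P) * A i * P = 0 := by
      calc (1 - P) * A i * P = (1 - P) * A i * Cᴴ * (C * G) := by
            rw [Matrix.mul_assoc _ Cᴴ, ← Matrix.mul_assoc Cᴴ, ← hC]
        _ = 0 := by rw [h1, Matrix.zero_mul]
    rw [Matrix.sub_mul, Matrix.sub_mul, Matrix.one_mul, sub_eq_zero, Matrix.mul_assoc P] at h2
    exact h2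
  have hP1 : P = 1 := by
    by_contra h
    exact hirr ⟨P, hPP, hPsa, hP0, h, hPZ, hinv⟩
  exact IsUnit.of_mul_eq_one G hP1

theorem hasEigenvalue_channel_iff {A : ι → Matrix ν ν ℂ} {μ : ℂ} :
    (channel A).HasEigenvalue μ ↔ (transfer A).charpoly.IsRoot μ := by
  rw [Module.End.hasEigenvalue_iff_isRoot_charpoly, charpoly_channel]

theorem GradedNormal.hasEigenvalue_one {A : ι → Matrix ν ν ℂ} {Z : Matrix ν ν ℂ} {k : ℕ}
    (hk : k ≠ 0) (hA : GradedNormal A Z k) : (channel A).HasEigenvalue 1 := by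
  rw [hasEigenvalue_channel_iff]
  by_contra h
  exact hk (hA.2.1.symm.trans (Polynomial.rootMultiplicity_eq_zero h))

theorem GradedNormal.finrank_eigenspace_le {A : ι → Matrix ν ν ℂ} {Z : Matrix ν ν ℂ} {k : ℕ}
    (hA : GradedNormal A Z k) : Module.finrank ℂ ((channel A).eigenspace 1) ≤ k := by
  have := (channel A).finrank_genEigenspace_le 1 1
  rwa [charpoly_channel, hA.2.1] at this

/-- A graded normal even tensor has an even positive definite fixed point. -/
theorem GradedNormal.exists_posDef_fixed_point {p : ι → ZMod 2} {A : ι → Matrix ν ν ℂ}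
    {Z : Matrix ν ν ℂ} (hZ : IsParityMatrix Z) (hA : EvenTensor p A Z) {k : ℕ} (hk : k ≠ 0)
    (hN : GradedNormal A Z k) :
    ∃ W : Matrix ν ν ℂ, W.PosDef ∧ Z * W * Z = W ∧ channel A W = W := by
  have h1 := hN.hasEigenvalue_one hk
  have : Nontrivial (Matrix ν ν ℂ) := by
    obtain ⟨v, hv⟩ := h1.exists_hasEigenvector
    exact ⟨v, 0, hv.2⟩
  have hspec : ∀ μ ∈ spectrum ℂ (channel A), ‖μ‖ ≤ 1 := by
    intro μ hμ
    rw [← Module.End.hasEigenvalue_iff_mem_spectrum, hasEigenvalue_channel_iff,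
      ← Matrix.mem_spectrum_iff_isRoot_charpoly] at hμ
    by_cases h : μ = 1
    · simp [h]
    · exact (hN.2.2 μ hμ h).le
  obtain ⟨X, hX0, hXne, hX⟩ := exists_nonneg_map_eq_self (E := channel A)
    (fun X hX => (posSemidef_channel A hX.posSemidef).nonneg)
    (channel_conjTranspose A) hspec h1
  have hZZ := hZ.mul_self
  have hZX : 0 ≤ Z * X * Z := by
    have := hX0.posSemidef.mul_mul_conjTranspose_same Z
    rw [hZ.conjTranspose_eq] at this
    exact this.nonneg
  have hconj : Z * (X + Z * X * Z) * Z = X + Z * X * Z := by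
    have : Z * (Z * X * Z) * Z = X := by
      calc Z * (Z * X * Z) * Z = (Z * Z) * X * (Z * Z) := by simp only [Matrix.mul_assoc]
        _ = X := by rw [hZZ, Matrix.one_mul, Matrix.mul_one]
    rw [Matrix.mul_add, Matrix.add_mul, this, add_comm]
  have hfix : channel A (X + Z * X * Z) = X + Z * X * Z := by
    rw [map_add, channel_parity_conj hZ hA, hX]
  refine ⟨X + Z * X * Z, ?_, hconj, hfix⟩
  refine hN.1.posDef_of_channel_eq_self (add_nonneg hX0 hZX).posSemidef ?_ ?_ hfix
  · intro h
    exact hXne (le_antisymm (h ▸ le_add_of_nonneg_right hZX) hX0)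
  · nth_rewrite 2 [← hconj]
    simp only [← Matrix.mul_assoc, hZZ, Matrix.one_mul]

theorem fixed_point_of_nondegenerate {p : ι → ZMod 2} {A : ι → Matrix ν ν ℂ}
    {Z : Matrix ν ν ℂ} (hZ : IsParityMatrix Z) (hA : EvenTensor p A Z)
    (hN : GradedNormal A Z 1) :
    ∃ X : Matrix ν ν ℂ, X.PosDef ∧ Z * X * Z = X ∧ channel A X = X ∧
      ∀ Y : Matrix ν ν ℂ, channel A Y = Y → ∃ c : ℂ, Y = c • X := by
  obtain ⟨X, hX, hZX, hfix⟩ := hN.exists_posDef_fixed_point hZ hA one_ne_zero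
  refine ⟨X, hX, hZX, hfix, fun Y hY => ?_⟩
  have hX0 : X ≠ 0 := by
    rintro rfl
    obtain ⟨v, hv⟩ := (hN.hasEigenvalue_one one_ne_zero).exists_hasEigenvector
    have := hX.isUnit
    rw [isUnit_zero_iff] at this
    exact hv.2 (by rw [← Matrix.one_mul v, ← this, Matrix.zero_mul])
  have hmem : ∀ Y, channel A Y = Y → Y ∈ (channel A).eigenspace 1 := fun Y hY => by
    rw [Module.End.mem_eigenspace_iff, hY, one_smul]
  obtain ⟨v, hv⟩ := finrank_le_one_iff.1 hN.finrank_eigenspace_le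
  obtain ⟨a, ha⟩ := hv ⟨X, hmem X hfix⟩
  obtain ⟨b, hb⟩ := hv ⟨Y, hmem Y hY⟩
  have ha' : a • (v : Matrix ν ν ℂ) = X := congrArg Subtype.val ha
  have hb' : b • (v : Matrix ν ν ℂ) = Y := congrArg Subtype.val hb
  have ha0 : a ≠ 0 := by
    rintro rfl
    exact hX0 (by rw [← ha', zero_smul])
  exact ⟨b * a⁻¹, by rw [← ha', smul_smul, mul_assoc, inv_mul_cancel₀ ha0, mul_one, hb']⟩

end

theorem pauliZ_kronecker_one {n : Type*} [DecidableEq n] :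
    pauliZ ⊗ₖ (1 : Matrix n n ℂ) =
      diagonal fun x : Bool × n => if x.1 then -1 else 1 := by
  rw [pauliZ, ← diagonal_one, diagonal_kronecker_diagonal]
  simp

theorem isParityMatrix_pauliZ_kronecker_one {n : Type*} [DecidableEq n] :
    IsParityMatrix (pauliZ ⊗ₖ (1 : Matrix n n ℂ)) := by
  rw [pauliZ_kronecker_one]
  refine ⟨isDiag_diagonal _, fun x => ?_⟩
  rw [diagonal_apply_eq]
  cases x.1 <;> simp

section
variable {n : Type*} [Fintype n] [DecidableEq n]

theorem pauliX_kronecker_one_mul_apply {l : Type*} (M : Matrix (Bool × n) l ℂ) (a : Bool) (i : n)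
    (c : l) : ((pauliX ⊗ₖ (1 : Matrix n n ℂ)) * M) (a, i) c = M (!a, i) c := by
  cases a <;> simp [Matrix.mul_apply, Fintype.sum_prod_type, pauliX, Matrix.one_apply]

theorem mul_pauliX_kronecker_one_apply {l : Type*} (M : Matrix l (Bool × n) ℂ) (a : Bool) (i : n)
    (c : l) : (M * (pauliX ⊗ₖ (1 : Matrix n n ℂ))) c (a, i) = M c (!a, i) := by
  cases a <;> simp [Matrix.mul_apply, Fintype.sum_prod_type, pauliX, Matrix.one_apply]

theorem pauliX_conjTranspose : pauliXᴴ = pauliX := by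
  ext a b; cases a <;> cases b <;> simp [pauliX]

theorem pauliX_mul_self : pauliX * pauliX = 1 := by
  ext a b; cases a <;> cases b <;> simp [pauliX, Matrix.mul_apply]

theorem pauliZ_mul_self : pauliZ * pauliZ = 1 := by
  ext a b; cases a <;> cases b <;> simp [pauliZ]

theorem pauliZ_mul_pauliX : pauliZ * pauliX = -(pauliX * pauliZ) := by
  ext a b; cases a <;> cases b <;> simp [pauliZ, pauliX]

theorem pauliZ_mul_pauliX_mul_pauliZ : pauliZ * pauliX * pauliZ = -pauliX := by
  rw [pauliZ_mul_pauliX, Matrix.neg_mul, Matrix.mul_assoc, pauliZ_mul_self, Matrix.mul_one]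

theorem pauliZ_mul_pauliX_pow (x : ZMod 2) :
    pauliZ * pauliX ^ x.val = sgn x • (pauliX ^ x.val * pauliZ) := by
  obtain rfl | rfl : x = 0 ∨ x = 1 := by revert x; decide
  · simp [sgn]
  · simp [sgn, ZMod.val_one, pauliZ_mul_pauliX]

theorem evenTensor_pauliX_pow_kronecker {ι : Type*} (p : ι → ZMod 2) (B : ι → Matrix n n ℂ) :
    EvenTensor p (fun i => (pauliX ^ (p i).val) ⊗ₖ B i) (pauliZ ⊗ₖ (1 : Matrix n n ℂ)) := by
  intro i
  rw [← mul_kronecker_mul, ← mul_kronecker_mul, pauliZ_mul_pauliX_pow, smul_kronecker,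
    Matrix.one_mul, Matrix.mul_one]

theorem pauliX_pow_kronecker_mul_comm (k : ℕ) (M : Matrix n n ℂ) :
    ((pauliX ^ k) ⊗ₖ M) * (pauliX ⊗ₖ (1 : Matrix n n ℂ)) =
      (pauliX ⊗ₖ (1 : Matrix n n ℂ)) * ((pauliX ^ k) ⊗ₖ M) := by
  rw [← mul_kronecker_mul, ← mul_kronecker_mul, Matrix.one_mul, Matrix.mul_one, pow_mul_comm']

/-- A matrix commuting with `σᶻ ⊗ I` and `σˣ ⊗ I` has the form `I₂ ⊗ ρ`. -/
theorem eq_one_kronecker_submatrix {W : Matrix (Bool × n) (Bool × n) ℂ}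
    (hZ : (pauliZ ⊗ₖ (1 : Matrix n n ℂ)) * W * (pauliZ ⊗ₖ (1 : Matrix n n ℂ)) = W)
    (hX : (pauliX ⊗ₖ (1 : Matrix n n ℂ)) * W = W * (pauliX ⊗ₖ (1 : Matrix n n ℂ))) :
    (1 : Matrix Bool Bool ℂ) ⊗ₖ W.submatrix (Prod.mk false) (Prod.mk false) = W := by
  have hoff : ∀ a i j, W (a, i) (!a, j) = 0 := by
    intro a i j
    have h := congrFun₂ hZ (a, i) (!a, j)
    rw [pauliZ_kronecker_one, mul_diagonal, diagonal_mul] at h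
    cases a <;> simpa [neg_eq_self] using h
  have hdiag : ∀ i j, W (true, i) (true, j) = W (false, i) (false, j) := by
    intro i j
    have h := congrFun₂ hX (false, i) (true, j)
    rwa [pauliX_kronecker_one_mul_apply, mul_pauliX_kronecker_one_apply] at h
  ext ⟨a, i⟩ ⟨b, j⟩
  have h1 := hoff false i j
  have h2 := hoff true i j
  cases a <;> cases b <;> simp_all

theorem GradedNormal.exists_kronecker_fixed_points {ι : Type*} [Fintype ι] {p : ι → ZMod 2}
    {B : ι → Matrix n n ℂ}
    (hN : GradedNormal (fun i => (pauliX ^ (p i).val) ⊗ₖ B i)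
      (pauliZ ⊗ₖ (1 : Matrix n n ℂ)) 2) :
    ∃ ρ : Matrix n n ℂ, ρ.PosDef ∧ ∀ Y : Matrix (Bool × n) (Bool × n) ℂ,
      channel (fun i => (pauliX ^ (p i).val) ⊗ₖ B i) Y = Y ↔
        Y ∈ Submodule.span ℂ {(1 : Matrix Bool Bool ℂ) ⊗ₖ ρ, pauliX ⊗ₖ ρ} := by
  set A : ι → Matrix (Bool × n) (Bool × n) ℂ := fun i => (pauliX ^ (p i).val) ⊗ₖ B i with hA
  set Z : Matrix (Bool × n) (Bool × n) ℂ := pauliZ ⊗ₖ (1 : Matrix n n ℂ) with hZdef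
  set U : Matrix (Bool × n) (Bool × n) ℂ := pauliX ⊗ₖ (1 : Matrix n n ℂ) with hUdef
  obtain ⟨W, hW, hZW, hWfix⟩ := hN.exists_posDef_fixed_point isParityMatrix_pauliZ_kronecker_one
    (evenTensor_pauliX_pow_kronecker p B) two_ne_zero
  have hAU : ∀ j, A j * U = U * A j := fun j => pauliX_pow_kronecker_mul_comm _ _
  have hUU : U * U = 1 := by
    rw [hUdef, ← mul_kronecker_mul, pauliX_mul_self, Matrix.one_mul, one_kronecker_one]
  have hUh : Uᴴ = U := by
    rw [hUdef, conjTranspose_kronecker, pauliX_conjTranspose, conjTranspose_one]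
  have hZU : Z * U = -(U * Z) := by
    rw [hUdef, hZdef, ← mul_kronecker_mul, ← mul_kronecker_mul, pauliZ_mul_pauliX]
    ext; simp
  have hUZ : U * Z = -(Z * U) := by rw [hZU, neg_neg]
  set V := W + U * W * U with hV
  have hVpos : V.PosDef := by
    have := hW.posSemidef.mul_mul_conjTranspose_same U
    rw [hUh] at this
    exact hW.add_posSemidef this
  have hVfix : channel A V = V := by
    have h := channel_conj A (U := U) (fun _ => 1) (by simp) (by simpa using hAU) W
    rw [hUh, hWfix] at h
    rw [hV, map_add, hWfix, h]
  have hUV : U * V = V * U := by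
    rw [hV, Matrix.mul_add, Matrix.add_mul, Matrix.mul_assoc _ U U, hUU, Matrix.mul_assoc U W,
      ← Matrix.mul_assoc U U, hUU, Matrix.one_mul, Matrix.mul_one, add_comm]
  have hZV : Z * V * Z = V := by
    have : Z * (U * W * U) * Z = U * W * U := by
      calc Z * (U * W * U) * Z = (Z * U) * W * (U * Z) := by simp only [Matrix.mul_assoc]
        _ = -(U * Z) * W * -(Z * U) := by rw [← hZU, ← hUZ]
        _ = U * (Z * W * Z) * U := by
          simp only [Matrix.neg_mul, Matrix.mul_neg, neg_neg, Matrix.mul_assoc]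
        _ = U * W * U := by rw [hZW]
    rw [hV, Matrix.mul_add, Matrix.add_mul, this, hZW]
  set ρ := V.submatrix (Prod.mk false) (Prod.mk false) with hρ
  have hVρ : (1 : Matrix Bool Bool ℂ) ⊗ₖ ρ = V := eq_one_kronecker_submatrix hZV hUV
  have hρpos : ρ.PosDef := hVpos.submatrix (Prod.mk_right_injective false)
  have hUρ : U * V = pauliX ⊗ₖ ρ := by
    rw [← hVρ, hUdef, ← mul_kronecker_mul, Matrix.mul_one, Matrix.one_mul]
  have hρ0 : ρ ≠ 0 := by
    intro h
    obtain ⟨v, hv⟩ := (hN.hasEigenvalue_one two_ne_zero).exists_hasEigenvector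
    have hu := hVpos.isUnit
    rw [← hVρ, h, kronecker_zero, isUnit_zero_iff] at hu
    exact hv.2 (by rw [← Matrix.one_mul v, ← hu, Matrix.zero_mul])
  refine ⟨ρ, hρpos, ?_⟩
  have hmem : ∀ Y, channel A Y = Y ↔ Y ∈ (channel A).eigenspace 1 := fun Y => by
    rw [Module.End.mem_eigenspace_iff, one_smul]
  have hle : Submodule.span ℂ {(1 : Matrix Bool Bool ℂ) ⊗ₖ ρ, pauliX ⊗ₖ ρ} ≤
      (channel A).eigenspace 1 := by
    rw [Submodule.span_le, Set.insert_subset_iff, Set.singleton_subset_iff]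
    refine ⟨(hmem _).1 (by rw [hVρ, hVfix]), (hmem _).1 ?_⟩
    rw [← hUρ, channel_mul_of_commute A hAU, hVfix]
  have hli : LinearIndependent ℂ ![(1 : Matrix Bool Bool ℂ) ⊗ₖ ρ, pauliX ⊗ₖ ρ] := by
    rw [LinearIndependent.pair_iff]
    intro s t hst
    obtain ⟨i, j, hij⟩ : ∃ i j, ρ i j ≠ 0 := by
      by_contra! h
      exact hρ0 (Matrix.ext h)
    have h1 := congrFun₂ hst (false, i) (false, j)
    have h2 := congrFun₂ hst (false, i) (true, j)
    simp [pauliX, hij] at h1 h2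
    exact ⟨h1, h2⟩
  have hfin := finrank_span_eq_card hli
  rw [Matrix.range_cons_cons_empty, Fintype.card_fin] at hfin
  have heq := Submodule.eq_of_le_of_finrank_le hle (hN.finrank_eigenspace_le.trans_eq hfin.symm)
  intro Y
  rw [hmem, heq]

theorem pauliZ_conj_one_kronecker (ρ : Matrix n n ℂ) :
    (pauliZ ⊗ₖ (1 : Matrix n n ℂ)) * ((1 : Matrix Bool Bool ℂ) ⊗ₖ ρ) *
      (pauliZ ⊗ₖ (1 : Matrix n n ℂ)) = (1 : Matrix Bool Bool ℂ) ⊗ₖ ρ := by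
  rw [← mul_kronecker_mul, ← mul_kronecker_mul, Matrix.mul_one, pauliZ_mul_self, Matrix.one_mul,
    Matrix.mul_one]

theorem pauliZ_conj_pauliX_kronecker (ρ : Matrix n n ℂ) :
    (pauliZ ⊗ₖ (1 : Matrix n n ℂ)) * (pauliX ⊗ₖ ρ) * (pauliZ ⊗ₖ (1 : Matrix n n ℂ)) =
      -(pauliX ⊗ₖ ρ) := by
  rw [← mul_kronecker_mul, ← mul_kronecker_mul, pauliZ_mul_pauliX_mul_pauliZ, Matrix.one_mul,
    Matrix.mul_one]
  ext; simp

end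

/-- Fixed points of the completely positive map `X ↦ Σ_j A^j X (A^j)†`:
(a) for a graded normal non-degenerate tensor there is an even positive definite fixed
point, unique up to scalars; (b) for a graded normal degenerate tensor in the standard
form `A^i = (σˣ)^{|i|} ⊗ B^i` the fixed-point space is spanned by `I₂ ⊗ ρ` (even) and
`σˣ ⊗ ρ` (odd) with `ρ` positive definite. -/
theorem fixed_points_of_graded_normal :
    (∀ (d D : ℕ) (p : Fin d → ZMod 2) (Z : Matrix (Fin D) (Fin D) ℂ),
      IsParityMatrix Z →
      ∀ A : Fin d → Matrix (Fin D) (Fin D) ℂ, EvenTensor p A Z →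
        GradedNormal A Z 1 →
        ∃ X : Matrix (Fin D) (Fin D) ℂ, X.PosDef ∧ Z * X * Z = X ∧
          (∑ j, A j * X * (A j)ᴴ) = X ∧
          ∀ Y : Matrix (Fin D) (Fin D) ℂ,
            (∑ j, A j * Y * (A j)ᴴ) = Y → ∃ c : ℂ, Y = c • X) ∧
    (∀ (d m : ℕ) (p : Fin d → ZMod 2) (B : Fin d → Matrix (Fin m) (Fin m) ℂ),
      GradedNormal (fun i => (pauliX ^ (p i).val) ⊗ₖ B i)
          (pauliZ ⊗ₖ (1 : Matrix (Fin m) (Fin m) ℂ)) 2 →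
      ∃ ρ : Matrix (Fin m) (Fin m) ℂ, ρ.PosDef ∧
        (∀ Y : Matrix (Bool × Fin m) (Bool × Fin m) ℂ,
          (∑ j, ((pauliX ^ (p j).val) ⊗ₖ B j) * Y * ((pauliX ^ (p j).val) ⊗ₖ B j)ᴴ) = Y ↔
          Y ∈ Submodule.span ℂ
            ({(1 : Matrix Bool Bool ℂ) ⊗ₖ ρ, pauliX ⊗ₖ ρ} :
              Set (Matrix (Bool × Fin m) (Bool × Fin m) ℂ))) ∧
        (pauliZ ⊗ₖ (1 : Matrix (Fin m) (Fin m) ℂ)) * ((1 : Matrix Bool Bool ℂ) ⊗ₖ ρ) *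
            (pauliZ ⊗ₖ (1 : Matrix (Fin m) (Fin m) ℂ)) =
          (1 : Matrix Bool Bool ℂ) ⊗ₖ ρ ∧
        (pauliZ ⊗ₖ (1 : Matrix (Fin m) (Fin m) ℂ)) * (pauliX ⊗ₖ ρ) *
            (pauliZ ⊗ₖ (1 : Matrix (Fin m) (Fin m) ℂ)) =
          -(pauliX ⊗ₖ ρ)) := by
  refine ⟨fun d D p Z hZ A hA hN => fixed_point_of_nondegenerate hZ hA hN,
    fun d m p B hN => ?_⟩
  obtain ⟨ρ, hρ, hfix⟩ := hN.exists_kronecker_fixed_points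
  exact ⟨ρ, hρ, hfix, pauliZ_conj_one_kronecker ρ, pauliZ_conj_pauliX_kronecker ρ⟩
end

end FQCA
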